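/- Suppose A ∈ ℝ^{m×n} has rank r and Ã = A + E. Let I ⊆ [m], J ⊆ [n], and set C = A(:,J), U = A(I,J), C̃ = Ã(:,J), Ũ = Ã(I,J), E_J = E(:,J), E_{I,J} = E(I,J). Let Ũ_r be a best rank-r approximation of Ũ. If σ_r(U) > 4‖E_{I,J}‖₂, then for ‖·‖ either the spectral norm ‖·‖₂ or the Frobenius norm ‖·‖_F, ‖C̃Ũ_r† − CU†‖ ≤ ‖U†‖₂ (‖CU†‖₂‖E_{I,J}‖ + ‖E_J‖)/(1 − 4‖U†‖₂‖E_{I,J}‖₂) + 2√2 ‖CU†‖₂ ‖U†‖₂ ‖E_{I,J}‖. -/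

import Mathlib

open scoped BigOperators
open Matrix

noncomputable section

namespace TCUR

/-- Euclidean norm of a finite real vector. -/
def enorm {ι : Type*} [Fintype ι] (x : ι → ℝ) : ℝ :=
  Real.sqrt (∑ i, x i ^ 2)

/-- Frobenius norm of a real matrix. -/
def frob {m n : Type*} [Fintype m] [Fintype n] (A : Matrix m n ℝ) : ℝ :=
  Real.sqrt (∑ i, ∑ j, A i j ^ 2)

/-- Spectral norm of a real matrix. -/
def spec {m n : Type*} [Fintype m] [Fintype n] (A : Matrix m n ℝ) : ℝ :=
  sSup ((fun x => enorm (A.mulVec x)) '' {x : n → ℝ | enorm x ≤ 1})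

/-- The four Penrose conditions: `B` is the Moore–Penrose pseudoinverse of `A`. -/
def IsMP {m n : Type*} [Fintype m] [Fintype n] (A : Matrix m n ℝ) (B : Matrix n m ℝ) : Prop :=
  A * B * A = A ∧ B * A * B = B ∧ (A * B)ᵀ = A * B ∧ (B * A)ᵀ = B * A

open Classical in
/-- Moore–Penrose pseudoinverse of a real matrix (def body). -/
def pinv {m n : Type*} [Fintype m] [Fintype n] (A : Matrix m n ℝ) : Matrix n m ℝ :=
  if h : ∃ B, IsMP A B then h.choose else 0

/-- `sval k A` is the `k`-th largest singular value of `A`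
(via the Eckart–Young characterization). -/
def sval {m n : Type*} [Fintype m] [Fintype n] (k : ℕ) (A : Matrix m n ℝ) : ℝ :=
  sInf ((fun B => spec (A - B)) '' {B : Matrix m n ℝ | B.rank < k})

/-- `IsBestRank r A Ar`: `Ar` is a best rank-`r` (Frobenius) approximation of `A`,
 e.g. a rank-`r` truncated SVD of `A`. -/
def IsBestRank {m n : Type*} [Fintype m] [Fintype n] (r : ℕ) (A Ar : Matrix m n ℝ) : Prop :=
  Ar.rank ≤ r ∧ ∀ B : Matrix m n ℝ, B.rank ≤ r → frob (A - Ar) ≤ frob (A - B)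

/-- Compact SVD data: `A = W * S * Vᵀ` with `W, V` having orthonormal columns and
`S` diagonal with positive diagonal entries. -/
def CompactSVD {m n : Type*} [Fintype m] [Fintype n] {r : ℕ} (A : Matrix m n ℝ)
    (W : Matrix m (Fin r) ℝ) (S : Matrix (Fin r) (Fin r) ℝ) (V : Matrix n (Fin r) ℝ) : Prop :=
  A = W * S * Vᵀ ∧ Wᵀ * W = 1 ∧ Vᵀ * V = 1 ∧ (∀ i j, i ≠ j → S i j = 0) ∧ ∀ i, 0 < S i i

/-- Coherence `μ(W) = (d/r) max_i ‖W(i,:)‖₂²` of a matrix with orthonormal columns. -/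
def coh {m r : Type*} [Fintype m] [Fintype r] (W : Matrix m r ℝ) : ℝ :=
  ((Fintype.card m : ℝ) / (Fintype.card r : ℝ)) * ⨆ i : m, ∑ j, W i j ^ 2

/-- Row submatrix with rows restricted to `I`. -/
def rowsub {m k : Type*} (M : Matrix m k ℝ) (I : Finset m) : Matrix {x // x ∈ I} k ℝ :=
  M.submatrix Subtype.val id

/-- Probability, with respect to the uniform distribution on the finite sample space
`{ω : Ω | cond ω}`, of the event `{ω | event ω}`. -/
def uniformProb {Ω : Type*} [Fintype Ω] (cond event : Ω → Prop) : ℝ :=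
  (Nat.card {ω : Ω // cond ω ∧ event ω} : ℝ) / (Nat.card {ω : Ω // cond ω} : ℝ)

variable {n : ℕ}

/-- Mode-`k` unfolding of an `n`-mode tensor: the matrix whose columns are the
mode-`k` fibers of the tensor. -/
def unfold {ι : Fin n → Type*} (A : ((i : Fin n) → ι i) → ℝ) (k : Fin n) :
    Matrix (ι k) ((j : {j : Fin n // j ≠ k}) → ι j.1) ℝ :=
  fun x y => A fun i => if h : i = k then cast (congrArg ι h.symm) x else y ⟨i, h⟩

/-- Tucker (all-modes) product `T ×₁ M 1 ×₂ ⋯ ×ₙ M n`. -/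
def tucker {ι κ : Fin n → Type*} [∀ i, Fintype (κ i)]
    (T : ((i : Fin n) → κ i) → ℝ) (M : (i : Fin n) → Matrix (ι i) (κ i) ℝ) :
    ((i : Fin n) → ι i) → ℝ :=
  fun x => ∑ y : (i : Fin n) → κ i, (∏ i, M i (x i) (y i)) * T y

/-- The subtensor with mode-`i` indices restricted to `I i`. -/
def subT {ι : Fin n → Type*} (A : ((i : Fin n) → ι i) → ℝ)
    (I : (i : Fin n) → Finset (ι i)) : ((i : Fin n) → {x // x ∈ I i}) → ℝ :=
  fun x => A fun i => (x i).1

/-- Frobenius norm of a tensor. -/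
def tfrob {ι : Fin n → Type*} [∀ i, Fintype (ι i)] (A : ((i : Fin n) → ι i) → ℝ) : ℝ :=
  Real.sqrt (∑ x : (i : Fin n) → ι i, A x ^ 2)

/-- `Cmat A J i = 𝒜_(i)(:,J_i)`: the mode-`i` unfolding restricted to the columns `J i`. -/
def Cmat {ι : Fin n → Type*} (A : ((i : Fin n) → ι i) → ℝ)
    (J : (i : Fin n) → Finset ((j : {j : Fin n // j ≠ i}) → ι j.1)) (i : Fin n) :
    Matrix (ι i) {y // y ∈ J i} ℝ :=
  (unfold A i).submatrix id Subtype.val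

/-- `Umat A I J i = 𝒜_(i)(I_i,J_i)`. -/
def Umat {ι : Fin n → Type*} (A : ((i : Fin n) → ι i) → ℝ)
    (I : (i : Fin n) → Finset (ι i))
    (J : (i : Fin n) → Finset ((j : {j : Fin n // j ≠ i}) → ι j.1)) (i : Fin n) :
    Matrix {x // x ∈ I i} {y // y ∈ J i} ℝ :=
  (unfold A i).submatrix Subtype.val Subtype.val

/-- The Chidori column index set `⊗_{j ≠ i} I j`. -/
def chidoriJ {ι : Fin n → Type*} (I : (i : Fin n) → Finset (ι i)) (i : Fin n) :
    Finset ((j : {j : Fin n // j ≠ i}) → ι j.1) :=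
  Fintype.piFinset fun j => I j.1

/-- `σ_max(𝒜) = max_j σ₁(𝒜_(j))`. -/
def tsmax {ι : Fin n → Type*} [∀ i, Fintype (ι i)] (A : ((i : Fin n) → ι i) → ℝ) : ℝ :=
  ⨆ j, sval 1 (unfold A j)

/-- `σ_min(𝒜) = min_j σ_{r_j}(𝒜_(j))`. -/
def tsmin {ι : Fin n → Type*} [∀ i, Fintype (ι i)] (A : ((i : Fin n) → ι i) → ℝ)
    (r : Fin n → ℕ) : ℝ :=
  ⨅ j, sval (r j) (unfold A j)


/-- Column submatrix `M(:,J)`. -/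
def colsubM {m n : Type*} (M : Matrix m n ℝ) (J : Finset n) : Matrix m {y // y ∈ J} ℝ :=
  M.submatrix id Subtype.val

/-- Submatrix `M(I,J)`. -/
def subM {m n : Type*} (M : Matrix m n ℝ) (I : Finset m) (J : Finset n) :
    Matrix {x // x ∈ I} {y // y ∈ J} ℝ :=
  M.submatrix Subtype.val Subtype.val

section Vectors

variable {ι κ : Type*} [Fintype ι] [Fintype κ]

lemma enorm_nonneg (x : ι → ℝ) : 0 ≤ enorm x := Real.sqrt_nonneg _

lemma enorm_sq (x : ι → ℝ) : enorm x ^ 2 = x ⬝ᵥ x := by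
  rw [enorm, Real.sq_sqrt (by positivity)]
  simp [dotProduct, sq]

lemma enorm_eq_norm (x : ι → ℝ) : enorm x = ‖(WithLp.toLp 2 x : EuclideanSpace ℝ ι)‖ := by
  simp [enorm, EuclideanSpace.norm_eq]

lemma enorm_eq_zero {x : ι → ℝ} : enorm x = 0 ↔ x = 0 := by
  rw [enorm_eq_norm, norm_eq_zero, WithLp.toLp_eq_zero]

lemma enorm_pos {x : ι → ℝ} (hx : x ≠ 0) : 0 < enorm x :=
  lt_of_le_of_ne (enorm_nonneg x) fun h => hx (enorm_eq_zero.1 h.symm)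

lemma enorm_smul (c : ℝ) (x : ι → ℝ) : enorm (c • x) = |c| * enorm x := by
  rw [enorm_eq_norm, enorm_eq_norm, WithLp.toLp_smul, norm_smul, Real.norm_eq_abs]

lemma mulVec_dotProduct (M : Matrix ι κ ℝ) (x : κ → ℝ) (y : ι → ℝ) :
    M *ᵥ x ⬝ᵥ y = x ⬝ᵥ Mᵀ *ᵥ y := by
  rw [dotProduct_comm, dotProduct_mulVec, dotProduct_comm, mulVec_transpose]

end Vectors

section SpectralNorm

open scoped Matrix.Norms.L2Operator

variable {ι κ μ : Type*} [Fintype ι] [Fintype κ] [Fintype μ]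

lemma enorm_mulVec_le_l2 [DecidableEq κ] (M : Matrix ι κ ℝ) (x : κ → ℝ) :
    enorm (M *ᵥ x) ≤ ‖M‖ * enorm x := by
  rw [enorm_eq_norm, enorm_eq_norm]
  exact Matrix.l2_opNorm_mulVec M (WithLp.toLp 2 x)

lemma enorm_mulVec_le (M : Matrix ι κ ℝ) (x : κ → ℝ) :
    enorm (M *ᵥ x) ≤ spec M * enorm x := by
  classical
  by_cases hx : x = 0
  · simp [hx, enorm]
  have hpos := enorm_pos hx
  have hb : BddAbove ((fun x => enorm (M *ᵥ x)) '' {x : κ → ℝ | enorm x ≤ 1}) := by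
    refine ⟨‖M‖, ?_⟩
    rintro _ ⟨y, hy, rfl⟩
    exact (enorm_mulVec_le_l2 M y).trans (mul_le_of_le_one_right (norm_nonneg _) hy)
  have h : enorm (M *ᵥ ((enorm x)⁻¹ • x)) ≤ spec M := by
    refine le_csSup hb ⟨(enorm x)⁻¹ • x, ?_, rfl⟩
    simp [enorm_smul, abs_of_pos hpos, hpos.ne']
  rw [mulVec_smul, enorm_smul, abs_of_pos (inv_pos.2 hpos), inv_mul_le_iff₀ hpos] at h
  linarith

lemma spec_nonneg (M : Matrix ι κ ℝ) : 0 ≤ spec M := by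
  refine Real.sSup_nonneg ?_
  rintro _ ⟨y, -, rfl⟩
  exact enorm_nonneg _

lemma spec_le {M : Matrix ι κ ℝ} {c : ℝ} (hc : 0 ≤ c)
    (h : ∀ x, enorm (M *ᵥ x) ≤ c * enorm x) : spec M ≤ c := by
  refine Real.sSup_le ?_ hc
  rintro _ ⟨y, hy, rfl⟩
  exact (h y).trans (mul_le_of_le_one_right hc hy)

lemma spec_eq_l2 [DecidableEq κ] (M : Matrix ι κ ℝ) : spec M = ‖M‖ := by
  refine le_antisymm (spec_le (norm_nonneg _) (enorm_mulVec_le_l2 M)) ?_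
  rw [Matrix.l2_opNorm_def]
  refine ContinuousLinearMap.opNorm_le_bound _ (spec_nonneg M) fun x => ?_
  have := enorm_mulVec_le M x.ofLp
  rw [enorm_eq_norm, enorm_eq_norm] at this
  exact this

lemma spec_add_le (M N : Matrix ι κ ℝ) : spec (M + N) ≤ spec M + spec N := by
  classical
  simpa only [spec_eq_l2] using norm_add_le M N

lemma spec_sub_le (M N : Matrix ι κ ℝ) : spec (M - N) ≤ spec M + spec N := by
  classical
  simpa only [spec_eq_l2] using norm_sub_le M N

lemma spec_mul_le (M : Matrix ι κ ℝ) (N : Matrix κ μ ℝ) : spec (M * N) ≤ spec M * spec N := by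
  classical
  simpa only [spec_eq_l2] using Matrix.l2_opNorm_mul M N

lemma spec_transpose (M : Matrix ι κ ℝ) : spec Mᵀ = spec M := by
  classical
  rw [spec_eq_l2, spec_eq_l2, ← Matrix.l2_opNorm_conjTranspose M, conjTranspose_eq_transpose_of_trivial]

lemma spec_zero : spec (0 : Matrix ι κ ℝ) = 0 := by
  classical
  rw [spec_eq_l2, norm_zero]

end SpectralNorm

section FrobeniusNorm

variable {ι κ μ : Type*} [Fintype ι] [Fintype κ] [Fintype μ]

lemma frob_nonneg (M : Matrix ι κ ℝ) : 0 ≤ frob M := Real.sqrt_nonneg _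

lemma frob_sq (M : Matrix ι κ ℝ) : frob M ^ 2 = ∑ j, enorm (M.col j) ^ 2 := by
  rw [frob, Real.sq_sqrt (by positivity), Finset.sum_comm]
  refine Finset.sum_congr rfl fun j _ => ?_
  rw [enorm, Real.sq_sqrt (by positivity)]
  rfl

lemma frob_sq_eq_trace (M : Matrix ι κ ℝ) : frob M ^ 2 = (M * Mᵀ).trace := by
  rw [frob, Real.sq_sqrt (by positivity)]
  simp [trace, mul_apply, sq]

lemma frob_eq_enorm (M : Matrix ι κ ℝ) : frob M = enorm (fun p : ι × κ => M p.1 p.2) := by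
  rw [frob, enorm, Fintype.sum_prod_type]

lemma frob_add_le (M N : Matrix ι κ ℝ) : frob (M + N) ≤ frob M + frob N := by
  simp only [frob_eq_enorm, enorm_eq_norm]
  exact norm_add_le (WithLp.toLp 2 fun p : ι × κ => M p.1 p.2)
    (WithLp.toLp 2 fun p : ι × κ => N p.1 p.2 : EuclideanSpace ℝ (ι × κ))

lemma frob_neg (M : Matrix ι κ ℝ) : frob (-M) = frob M := by
  simp [frob]

lemma frob_sub_le (M N : Matrix ι κ ℝ) : frob (M - N) ≤ frob M + frob N := by
  simpa only [sub_eq_add_neg, frob_neg] using frob_add_le M (-N)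

lemma frob_transpose (M : Matrix ι κ ℝ) : frob Mᵀ = frob M := by
  rw [frob, frob, Finset.sum_comm]
  rfl

lemma eq_zero_of_frob_sq_le {M : Matrix ι κ ℝ} (h : frob M ^ 2 ≤ 0) : M = 0 := by
  have h0 : frob M = 0 := by nlinarith [frob_nonneg M]
  rw [frob_eq_enorm, enorm_eq_zero] at h0
  ext i j
  exact congrFun h0 (i, j)

lemma frob_mul_le_left (M : Matrix ι κ ℝ) (N : Matrix κ μ ℝ) :
    frob (M * N) ≤ spec M * frob N := by
  refine le_of_sq_le_sq ?_ (mul_nonneg (spec_nonneg _) (frob_nonneg _))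
  rw [mul_pow, frob_sq, frob_sq, Finset.mul_sum]
  refine Finset.sum_le_sum fun j _ => ?_
  rw [← mul_pow]
  exact pow_le_pow_left₀ (enorm_nonneg _) (enorm_mulVec_le M (N.col j)) 2

lemma frob_mul_le_right (M : Matrix ι κ ℝ) (N : Matrix κ μ ℝ) :
    frob (M * N) ≤ frob M * spec N := by
  have h := frob_mul_le_left Nᵀ Mᵀ
  rwa [← transpose_mul, frob_transpose, frob_transpose, spec_transpose, mul_comm] at h

lemma frob_sq_add_of_mul_transpose_eq_zero {M N : Matrix ι κ ℝ} (h : M * Nᵀ = 0) :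
    frob (M + N) ^ 2 = frob M ^ 2 + frob N ^ 2 := by
  have h' : N * Mᵀ = 0 := by simpa using congrArg transpose h
  simp [frob_sq_eq_trace, Matrix.mul_add, Matrix.add_mul, h, h']

lemma frob_sq_add_of_transpose_mul_eq_zero {M N : Matrix ι κ ℝ} (h : Mᵀ * N = 0) :
    frob (M + N) ^ 2 = frob M ^ 2 + frob N ^ 2 := by
  rw [← frob_transpose, ← frob_transpose M, ← frob_transpose N, transpose_add]
  exact frob_sq_add_of_mul_transpose_eq_zero (by simpa using h)

lemma frob_sq_vecMulVec (a : ι → ℝ) (b : κ → ℝ) :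
    frob (vecMulVec a b) ^ 2 = enorm a ^ 2 * enorm b ^ 2 := by
  rw [frob, Real.sq_sqrt (by positivity), enorm, enorm, Real.sq_sqrt (by positivity),
    Real.sq_sqrt (by positivity), Finset.sum_mul_sum]
  simp [vecMulVec_apply, mul_pow]

end FrobeniusNorm

section PseudoInverse

variable {ι κ : Type*} [Fintype ι] [Fintype κ]

lemma exists_symm_pinv [DecidableEq κ] {G : Matrix κ κ ℝ} (hG : G.IsHermitian) :
    ∃ H : Matrix κ κ ℝ, G * H * G = G ∧ H * G * H = H ∧ Hᵀ = H ∧ G * H = H * G := by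
  obtain ⟨V, d, hV, hGd⟩ : ∃ (V : Matrix κ κ ℝ) (d : κ → ℝ), Vᵀ * V = 1 ∧
      G = V * diagonal d * Vᵀ := by
    refine ⟨hG.eigenvectorUnitary, hG.eigenvalues, ?_, ?_⟩
    · have := Unitary.coe_star_mul_self hG.eigenvectorUnitary
      rwa [star_eq_conjTranspose, conjTranspose_eq_transpose_of_trivial] at this
    · have := hG.spectral_theorem
      rw [Unitary.conjStarAlgAut_apply, star_eq_conjTranspose,
        conjTranspose_eq_transpose_of_trivial] at this
      exact this
  have key (a b : κ → ℝ) : V * diagonal a * Vᵀ * (V * diagonal b * Vᵀ) =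
      V * diagonal (a * b) * Vᵀ := by
    calc V * diagonal a * Vᵀ * (V * diagonal b * Vᵀ)
        = V * diagonal a * (Vᵀ * V) * diagonal b * Vᵀ := by simp only [Matrix.mul_assoc]
      _ = V * diagonal (a * b) * Vᵀ := by
        rw [hV, Matrix.mul_one, Matrix.mul_assoc V, diagonal_mul_diagonal']
        rfl
  refine ⟨V * diagonal d⁻¹ * Vᵀ, ?_, ?_, ?_, ?_⟩
  · rw [hGd, key, key]
    congr 3
    ext i
    simp
  · rw [hGd, key, key]
    congr 3
    ext i
    by_cases hi : d i = 0 <;> simp [hi]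
  · simp [Matrix.mul_assoc]
  · rw [hGd, key, key, mul_comm]

lemma exists_isMP (M : Matrix ι κ ℝ) : ∃ B, IsMP M B := by
  classical
  obtain ⟨H, h1, h2, h3, h4⟩ := exists_symm_pinv (G := Mᵀ * M)
    (by simpa using isHermitian_conjTranspose_mul_self M)
  have hM : M * (H * (Mᵀ * M)) = M := by
    rw [← sub_eq_zero, ← Matrix.conjTranspose_mul_self_eq_zero,
      conjTranspose_eq_transpose_of_trivial]
    have : Mᵀ * (M * (H * (Mᵀ * M)) - M) = 0 := by
      rw [Matrix.mul_sub, sub_eq_zero, ← Matrix.mul_assoc, ← Matrix.mul_assoc, h1]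
    have h : (M * (H * (Mᵀ * M)) - M)ᵀ = ((H * (Mᵀ * M))ᵀ - 1) * Mᵀ := by
      rw [transpose_sub, transpose_mul, Matrix.sub_mul, Matrix.one_mul]
    rw [h, Matrix.mul_assoc, this, Matrix.mul_zero]
  refine ⟨H * Mᵀ, ?_, ?_, ?_, ?_⟩
  · simpa only [Matrix.mul_assoc] using hM
  · have := congrArg (· * Mᵀ) h2
    simpa only [Matrix.mul_assoc] using this
  · simp [h3, Matrix.mul_assoc]
  · rw [Matrix.mul_assoc, ← h4]
    simp [h3, h4]

lemma isMP_pinv (M : Matrix ι κ ℝ) : IsMP M (pinv M) := by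
  have h := exists_isMP M
  rw [pinv, dif_pos h]
  exact h.choose_spec

lemma mul_pinv_mul (M : Matrix ι κ ℝ) : M * pinv M * M = M := (isMP_pinv M).1

lemma pinv_mul_pinv (M : Matrix ι κ ℝ) : pinv M * M * pinv M = pinv M := (isMP_pinv M).2.1

lemma transpose_mul_pinv (M : Matrix ι κ ℝ) : (M * pinv M)ᵀ = M * pinv M := (isMP_pinv M).2.2.1

lemma transpose_pinv_mul (M : Matrix ι κ ℝ) : (pinv M * M)ᵀ = pinv M * M := (isMP_pinv M).2.2.2

lemma rank_pinv_mul (M : Matrix ι κ ℝ) : (pinv M * M).rank = M.rank := by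
  refine le_antisymm (rank_mul_le_right _ _) ?_
  conv_lhs => rw [← mul_pinv_mul M, Matrix.mul_assoc]
  exact rank_mul_le_right _ _

/-- A symmetric idempotent matrix is a contraction. -/
lemma enorm_mulVec_le_of_projection {P : Matrix ι ι ℝ} (hs : Pᵀ = P) (hi : P * P = P)
    (x : ι → ℝ) : enorm (P *ᵥ x) ≤ enorm x := by
  have h : enorm x ^ 2 = enorm (P *ᵥ x) ^ 2 + enorm (x - P *ᵥ x) ^ 2 := by
    have : P *ᵥ x ⬝ᵥ P *ᵥ x = x ⬝ᵥ P *ᵥ x := by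
      rw [mulVec_dotProduct, hs, mulVec_mulVec, hi]
    simp only [enorm_sq, sub_dotProduct, dotProduct_sub, dotProduct_comm (P *ᵥ x) x, this]
    ring
  refine le_of_sq_le_sq ?_ (enorm_nonneg _)
  nlinarith [sq_nonneg (enorm (x - P *ᵥ x))]

lemma mul_pinv_idem (M : Matrix ι κ ℝ) : M * pinv M * (M * pinv M) = M * pinv M := by
  rw [← Matrix.mul_assoc, mul_pinv_mul]

lemma pinv_mul_idem (M : Matrix ι κ ℝ) : pinv M * M * (pinv M * M) = pinv M * M := by
  rw [← Matrix.mul_assoc, pinv_mul_pinv]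

end PseudoInverse

section Rank

variable {ι κ : Type*} [Fintype κ]

lemma exists_ne_zero_mem_mulVec_eq_zero (B : Matrix ι κ ℝ) (K : Submodule ℝ (κ → ℝ))
    (h : B.rank < Module.finrank ℝ K) : ∃ w ∈ K, w ≠ 0 ∧ B *ᵥ w = 0 := by
  have hk := LinearMap.ker_ne_bot_of_finrank_lt
    (f := B.mulVecLin.rangeRestrict ∘ₗ K.subtype) h
  obtain ⟨w, hw, hw0⟩ := Submodule.exists_mem_ne_zero_of_ne_bot hk
  refine ⟨w, w.2, by simpa using hw0, ?_⟩
  have := congrArg Subtype.val (LinearMap.mem_ker.1 hw)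
  simpa using this

lemma rank_add_finrank_ker (M : Matrix ι κ ℝ) :
    M.rank + Module.finrank ℝ (LinearMap.ker M.mulVecLin) = Fintype.card κ := by
  have := LinearMap.finrank_range_add_finrank_ker M.mulVecLin
  rwa [Module.finrank_fintype_fun_eq_card] at this

lemma matrix_rank_add_le (M N : Matrix ι κ ℝ) : (M + N).rank ≤ M.rank + N.rank := by
  rw [Matrix.rank, mulVecLin_add]
  exact (Submodule.finrank_mono (LinearMap.range_add_le _ _)).trans
    (Submodule.finrank_add_le_finrank_add_finrank _ _)

variable [Fintype ι]

/-- Deflating `M` along a vector outside its kernel lowers the rank. -/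
lemma rank_sub_vecMulVec_lt (M : Matrix ι κ ℝ) {y : κ → ℝ} (hy : pinv M *ᵥ (M *ᵥ y) = y)
    (hy0 : y ≠ 0) :
    (M - vecMulVec (M *ᵥ y) ((enorm y ^ 2)⁻¹ • y)).rank < M.rank := by
  set B := M - vecMulVec (M *ᵥ y) ((enorm y ^ 2)⁻¹ • y) with hB
  have hpos := enorm_pos hy0
  have hBv (v : κ → ℝ) : B *ᵥ v = M *ᵥ v - ((enorm y ^ 2)⁻¹ * (y ⬝ᵥ v)) • M *ᵥ y := by
    rw [hB, sub_mulVec, vecMulVec_mulVec, smul_dotProduct, op_smul_eq_smul, smul_eq_mul]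
  have hlt : LinearMap.ker M.mulVecLin < LinearMap.ker B.mulVecLin := by
    refine SetLike.lt_iff_le_and_exists.2 ⟨fun v hv => ?_, y, ?_, ?_⟩
    · have hv' : M *ᵥ v = 0 := hv
      have hyv : y ⬝ᵥ v = 0 := by
        rw [← hy, mulVec_mulVec, mulVec_dotProduct, transpose_pinv_mul, ← mulVec_mulVec, hv',
          mulVec_zero, dotProduct_zero]
      change B *ᵥ v = 0
      rw [hBv, hv', hyv, mul_zero, zero_smul, sub_zero]
    · change B *ᵥ y = 0
      rw [hBv, ← enorm_sq, inv_mul_cancel₀ (by positivity), one_smul, sub_self]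
    · intro h
      have h' : M *ᵥ y = 0 := h
      rw [h', mulVec_zero] at hy
      exact hy0 hy.symm
  have h1 := Submodule.finrank_lt_finrank_of_lt hlt
  have h2 := rank_add_finrank_ker M
  have h3 := rank_add_finrank_ker B
  omega

/-- Lower half of the singular value characterization of the pseudoinverse. -/
lemma one_le_spec_pinv_mul_spec_sub (M B : Matrix ι κ ℝ) (h : B.rank < M.rank) :
    1 ≤ spec (pinv M) * spec (M - B) := by
  obtain ⟨w, hw, hw0, hBw⟩ := exists_ne_zero_mem_mulVec_eq_zero B
    (LinearMap.range (pinv M * M).mulVecLin) (by rw [← rank_pinv_mul M] at h; exact h)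
  obtain ⟨z, rfl⟩ := hw
  set w := (pinv M * M).mulVecLin z
  have hw : pinv M *ᵥ (M *ᵥ w) = w := by
    change pinv M *ᵥ (M *ᵥ ((pinv M * M) *ᵥ z)) = (pinv M * M) *ᵥ z
    rw [mulVec_mulVec, mulVec_mulVec, pinv_mul_idem]
  have hpos := enorm_pos hw0
  have h1 := enorm_mulVec_le (pinv M) (M *ᵥ w)
  have h2 := enorm_mulVec_le (M - B) w
  rw [sub_mulVec, hBw, sub_zero] at h2
  rw [hw] at h1
  have h3 := mul_le_mul_of_nonneg_left h2 (spec_nonneg (pinv M))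
  refine le_of_mul_le_mul_right ?_ hpos
  linarith

/-- Upper half of the singular value characterization of the pseudoinverse. -/
lemma exists_rank_lt_spec_sub_mul_le (M : Matrix ι κ ℝ) (x : ι → ℝ) (hx : pinv M *ᵥ x ≠ 0) :
    ∃ B : Matrix ι κ ℝ, B.rank < M.rank ∧ spec (M - B) * enorm (pinv M *ᵥ x) ≤ enorm x := by
  set y := pinv M *ᵥ x with hy
  have hpos := enorm_pos hx
  refine ⟨_, rank_sub_vecMulVec_lt M (y := y) (by simp only [hy, mulVec_mulVec,
    ← Matrix.mul_assoc, pinv_mul_pinv]) hx, ?_⟩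
  rw [sub_sub_cancel, ← le_div_iff₀ hpos]
  refine spec_le (div_nonneg (enorm_nonneg _) hpos.le) fun v => ?_
  have hMy : enorm (M *ᵥ y) ≤ enorm x := by
    rw [hy, mulVec_mulVec]
    exact enorm_mulVec_le_of_projection (transpose_mul_pinv M) (mul_pinv_idem M) x
  have hcs : |y ⬝ᵥ v| ≤ enorm y * enorm v := by
    rw [enorm_eq_norm, enorm_eq_norm]
    have := abs_real_inner_le_norm (WithLp.toLp 2 v : EuclideanSpace ℝ κ) (WithLp.toLp 2 y)
    rw [EuclideanSpace.inner_toLp_toLp] at this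
    simpa [mul_comm] using this
  rw [vecMulVec_mulVec, smul_dotProduct, op_smul_eq_smul, smul_eq_mul, enorm_smul, abs_mul,
    abs_of_pos (inv_pos.2 (pow_pos hpos 2))]
  calc (enorm y ^ 2)⁻¹ * |y ⬝ᵥ v| * enorm (M *ᵥ y)
      ≤ (enorm y ^ 2)⁻¹ * (enorm y * enorm v) * enorm x :=
        mul_le_mul (mul_le_mul_of_nonneg_left hcs (by positivity)) hMy (enorm_nonneg _)
          (mul_nonneg (by positivity) (mul_nonneg hpos.le (enorm_nonneg _)))
    _ = enorm x / enorm y * enorm v := by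
        field_simp

end Rank

section BestApproximation

variable {ι κ : Type*} [Fintype ι] [Fintype κ] {r : ℕ} {M X : Matrix ι κ ℝ}

lemma IsBestRank.transpose (h : IsBestRank r M X) : IsBestRank r Mᵀ Xᵀ := by
  refine ⟨by rw [rank_transpose]; exact h.1, fun B hB => ?_⟩
  rw [← transpose_sub, frob_transpose, ← frob_transpose (Mᵀ - B), transpose_sub,
    transpose_transpose]
  exact h.2 Bᵀ (by rwa [rank_transpose])

lemma IsBestRank.frob_sq_le (h : IsBestRank r M X) {B : Matrix ι κ ℝ} (hB : B.rank ≤ r) :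
    frob (M - X) ^ 2 ≤ frob (M - B) ^ 2 :=
  pow_le_pow_left₀ (frob_nonneg _) (h.2 B hB) 2

lemma IsBestRank.projection_mul_sub (h : IsBestRank r M X) {P : Matrix ι ι ℝ} (hs : Pᵀ = P)
    (hi : P * P = P) (hPX : P * X = X) (hP : P.rank ≤ r) : P * (M - X) = 0 := by
  have hle := h.frob_sq_le (B := P * M) ((rank_mul_le_left _ _).trans hP)
  have hz : (P * M - X)ᵀ * (M - P * M) = 0 := by
    have : P * M - X = P * (M - X) := by rw [Matrix.mul_sub, hPX]
    rw [this, transpose_mul, hs, Matrix.mul_assoc, Matrix.mul_sub P, ← Matrix.mul_assoc P, hi,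
      sub_self, Matrix.mul_zero]
  have hsum := frob_sq_add_of_transpose_mul_eq_zero hz
  rw [sub_add_sub_comm, add_comm, ← sub_add_sub_comm, sub_self, add_zero] at hsum
  have : P * M - X = 0 := eq_zero_of_frob_sq_le (by linarith)
  rw [Matrix.mul_sub, hPX, this]

lemma IsBestRank.mul_pinv_mul_sub (h : IsBestRank r M X) : X * pinv X * (M - X) = 0 :=
  h.projection_mul_sub (transpose_mul_pinv X) (mul_pinv_idem X) (mul_pinv_mul X)
    ((rank_mul_le_left _ _).trans h.1)

lemma IsBestRank.sub_mul_pinv_mul (h : IsBestRank r M X) : (M - X) * (pinv X * X) = 0 := by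
  have := h.transpose.projection_mul_sub (transpose_pinv_mul X) (pinv_mul_idem X)
    (by rw [← transpose_pinv_mul, ← transpose_mul, ← Matrix.mul_assoc, mul_pinv_mul])
    ((rank_mul_le_right _ _).trans h.1)
  rw [← transpose_pinv_mul, ← transpose_sub, ← transpose_mul] at this
  exact transpose_eq_zero.1 this

lemma IsBestRank.sub_mul_pinv (h : IsBestRank r M X) : (M - X) * pinv X = 0 := by
  rw [← pinv_mul_pinv X, ← Matrix.mul_assoc, h.sub_mul_pinv_mul, Matrix.zero_mul]

lemma frob_sq_sub_vecMulVec (D : Matrix ι κ ℝ) {v : κ → ℝ} (hv : v ≠ 0) :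
    (D - vecMulVec (D *ᵥ v) ((enorm v ^ 2)⁻¹ • v)) *ᵥ v = 0 ∧
    frob (D - vecMulVec (D *ᵥ v) ((enorm v ^ 2)⁻¹ • v)) ^ 2 =
      frob D ^ 2 - enorm (D *ᵥ v) ^ 2 / enorm v ^ 2 := by
  have hpos := enorm_pos hv
  have h0 : (D - vecMulVec (D *ᵥ v) ((enorm v ^ 2)⁻¹ • v)) *ᵥ v = 0 := by
    rw [sub_mulVec, vecMulVec_mulVec, smul_dotProduct, op_smul_eq_smul, smul_eq_mul, ← enorm_sq,
      inv_mul_cancel₀ (by positivity), one_smul, sub_self]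
  refine ⟨h0, ?_⟩
  have h := frob_sq_add_of_mul_transpose_eq_zero
    (M := D - vecMulVec (D *ᵥ v) ((enorm v ^ 2)⁻¹ • v))
    (N := vecMulVec (D *ᵥ v) ((enorm v ^ 2)⁻¹ • v))
    (by rw [transpose_vecMulVec, mul_vecMulVec, mulVec_smul, h0, smul_zero, zero_vecMulVec])
  rw [sub_add_cancel, frob_sq_vecMulVec, enorm_smul, abs_of_pos (inv_pos.2 (pow_pos hpos 2))] at h
  rw [h]
  field_simp
  ring

/-- If the rank constraint is not active, the residual of a best approximation vanishes. -/
lemma IsBestRank.mulVec_sub_eq_zero (h : IsBestRank r M X) (hr : X.rank < r) (v : κ → ℝ) :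
    (M - X) *ᵥ v = 0 := by
  by_cases hv : v = 0
  · rw [hv, mulVec_zero]
  have hpos := enorm_pos hv
  have hle := h.frob_sq_le (B := X + vecMulVec ((M - X) *ᵥ v) ((enorm v ^ 2)⁻¹ • v)) (by
    refine (matrix_rank_add_le _ _).trans ?_
    have := rank_vecMulVec_le ((M - X) *ᵥ v) ((enorm v ^ 2)⁻¹ • v)
    omega)
  rw [← sub_sub, (frob_sq_sub_vecMulVec (M - X) hv).2] at hle
  have h0 : enorm ((M - X) *ᵥ v) ^ 2 / enorm v ^ 2 ≤ 0 := by linarith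
  rw [div_le_iff₀ (by positivity), zero_mul] at h0
  exact enorm_eq_zero.1 (pow_eq_zero_iff two_ne_zero |>.1 (le_antisymm h0 (sq_nonneg _)))

/-- The residual of a best approximation stretches no vector orthogonal to the row space of `X`
more than `X` stretches any vector of its row space. -/
lemma IsBestRank.enorm_sub_mulVec_mul_le (h : IsBestRank r M X) {v y : κ → ℝ}
    (hv : pinv X *ᵥ (X *ᵥ v) = 0) (hy : pinv X *ᵥ (X *ᵥ y) = y) :
    enorm ((M - X) *ᵥ v) * enorm y ≤ enorm (X *ᵥ y) * enorm v := by
  by_cases hv0 : v = 0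
  · simp [hv0, enorm]
  by_cases hy0 : y = 0
  · simp [hy0, enorm]
  have hvpos := enorm_pos hv0
  have hypos := enorm_pos hy0
  obtain ⟨h1, h2⟩ := frob_sq_sub_vecMulVec (M - X) hv0
  set F := vecMulVec ((M - X) *ᵥ v) ((enorm v ^ 2)⁻¹ • v) with hF
  set Y := vecMulVec (X *ᵥ y) ((enorm y ^ 2)⁻¹ • y) with hY
  have hle := h.frob_sq_le (B := X - Y + F) (by
    refine (matrix_rank_add_le _ _).trans ?_
    have e1 := rank_vecMulVec_le ((M - X) *ᵥ v) ((enorm v ^ 2)⁻¹ • v)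
    have e2 := rank_sub_vecMulVec_lt X hy hy0
    have e3 := h.1
    rw [← hF] at e1
    rw [← hY] at e2
    omega)
  have hDy : (M - X) *ᵥ y = 0 := by
    rw [← hy, mulVec_mulVec y, mulVec_mulVec, h.sub_mul_pinv_mul, zero_mulVec]
  have hvy : v ⬝ᵥ y = 0 := by
    rw [← hy, dotProduct_comm, mulVec_mulVec, mulVec_dotProduct, transpose_pinv_mul,
      ← mulVec_mulVec, hv, dotProduct_zero]
  have hz : (M - X - F) * Yᵀ = 0 := by
    rw [hY, transpose_vecMulVec, mul_vecMulVec, mulVec_smul, sub_mulVec, hDy, hF,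
      vecMulVec_mulVec, smul_dotProduct, hvy]
    simp
  have hsum := frob_sq_add_of_mul_transpose_eq_zero hz
  have heq : M - (X - Y + F) = M - X - F + Y := by abel
  have hYn : frob Y ^ 2 = enorm (X *ᵥ y) ^ 2 / enorm y ^ 2 := by
    rw [hY, frob_sq_vecMulVec, enorm_smul, abs_of_pos (inv_pos.2 (pow_pos hypos 2))]
    field_simp
  rw [heq, hsum, h2, hYn] at hle
  have hdiv : enorm ((M - X) *ᵥ v) ^ 2 / enorm v ^ 2 ≤ enorm (X *ᵥ y) ^ 2 / enorm y ^ 2 := by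
    linarith
  rw [div_le_div_iff₀ (by positivity) (by positivity), ← mul_pow, ← mul_pow] at hdiv
  exact le_of_sq_le_sq hdiv (mul_nonneg (enorm_nonneg _) (enorm_nonneg _))

/-- A best rank-`r` approximation in the Frobenius norm is also one in the spectral norm. -/
lemma IsBestRank.spec_sub_le (h : IsBestRank r M X) {B : Matrix ι κ ℝ} (hB : B.rank ≤ r) :
    spec (M - X) ≤ spec (M - B) := by
  refine spec_le (spec_nonneg _) fun x => ?_
  rcases h.1.lt_or_eq with hr | hr
  · rw [h.mulVec_sub_eq_zero hr x]
    have := mul_nonneg (spec_nonneg (M - B)) (enorm_nonneg x)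
    simpa [enorm] using this
  set Q := pinv X * X with hQ
  set v := x - Q *ᵥ x with hv
  have hQv : Q *ᵥ v = 0 := by
    rw [hv, mulVec_sub, mulVec_mulVec, hQ, pinv_mul_idem, sub_self]
  have hDv : (M - X) *ᵥ v = (M - X) *ᵥ x := by
    rw [hv, mulVec_sub, mulVec_mulVec, hQ, h.sub_mul_pinv_mul, zero_mulVec, sub_zero]
  have hvx : enorm v ≤ enorm x := by
    classical
    have hs : (1 - Q)ᵀ = 1 - Q := by rw [transpose_sub, transpose_one, hQ, transpose_pinv_mul]
    have hi : (1 - Q) * (1 - Q) = 1 - Q := by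
      rw [Matrix.mul_sub, Matrix.sub_mul, Matrix.sub_mul, hQ, pinv_mul_idem]
      simp
    have := enorm_mulVec_le_of_projection hs hi x
    rwa [sub_mulVec, one_mulVec] at this
  rw [← hDv]
  refine le_trans ?_ (mul_le_mul_of_nonneg_left hvx (spec_nonneg _))
  by_cases hv0 : v = 0
  · simp [hv0, enorm]
  have hvK : v ∉ LinearMap.range Q.mulVecLin := by
    rintro ⟨z, hz⟩
    apply hv0
    rw [← hQv, ← hz, mulVecLin_apply, mulVec_mulVec, hQ, pinv_mul_idem]
  have hlt : B.rank < Module.finrank ℝ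
      (LinearMap.range Q.mulVecLin ⊔ Submodule.span ℝ {v} : Submodule ℝ (κ → ℝ)) := by
    have hss : LinearMap.range Q.mulVecLin < LinearMap.range Q.mulVecLin ⊔ Submodule.span ℝ {v} :=
      SetLike.lt_iff_le_and_exists.2 ⟨le_sup_left, v,
        Submodule.mem_sup_right (Submodule.mem_span_singleton_self v), hvK⟩
    have e1 := Submodule.finrank_lt_finrank_of_lt hss
    have e2 : Module.finrank ℝ (LinearMap.range Q.mulVecLin) = X.rank := rank_pinv_mul X
    omega
  obtain ⟨w, hw, hw0, hBw⟩ := exists_ne_zero_mem_mulVec_eq_zero B _ hlt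
  obtain ⟨y, ⟨z, hz⟩, u, hu, rfl⟩ := Submodule.mem_sup.1 hw
  obtain ⟨t, rfl⟩ := Submodule.mem_span_singleton.1 hu
  have hQy : Q *ᵥ y = y := by
    rw [← hz, mulVecLin_apply, mulVec_mulVec, hQ, pinv_mul_idem]
  have hXv : X *ᵥ v = 0 := by
    rw [← mul_pinv_mul X, Matrix.mul_assoc, ← hQ, ← mulVec_mulVec, hQv, mulVec_zero]
  have hDy : (M - X) *ᵥ y = 0 := by
    rw [← hQy, mulVec_mulVec, hQ, h.sub_mul_pinv_mul, zero_mulVec]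
  have hyv : y ⬝ᵥ v = 0 := by
    rw [← hQy, mulVec_dotProduct, hQ, transpose_pinv_mul, ← hQ, hQv, dotProduct_zero]
  have hXD : X *ᵥ y ⬝ᵥ (M - X) *ᵥ v = 0 := by
    rw [← mul_pinv_mul X, ← mulVec_mulVec, mulVec_dotProduct, transpose_mul_pinv, mul_pinv_mul,
      mulVec_mulVec, h.mul_pinv_mul_sub, zero_mulVec, dotProduct_zero]
  have hMw : (M - B) *ᵥ (y + t • v) = X *ᵥ y + t • (M - X) *ᵥ v := by
    rw [sub_mulVec, hBw, sub_zero]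
    have : M *ᵥ (y + t • v) = X *ᵥ (y + t • v) + (M - X) *ᵥ (y + t • v) := by
      rw [← add_mulVec, add_sub_cancel]
    rw [this, mulVec_add, mulVec_add, mulVec_smul, mulVec_smul, hXv, hDy]
    simp
  have hn1 : enorm (y + t • v) ^ 2 = enorm y ^ 2 + t ^ 2 * enorm v ^ 2 := by
    simp only [enorm_sq, add_dotProduct, dotProduct_add, smul_dotProduct, dotProduct_smul,
      dotProduct_comm v y, hyv, smul_eq_mul]
    ring
  have hn2 : enorm ((M - B) *ᵥ (y + t • v)) ^ 2 =
      enorm (X *ᵥ y) ^ 2 + t ^ 2 * enorm ((M - X) *ᵥ v) ^ 2 := by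
    rw [hMw]
    simp only [enorm_sq, add_dotProduct, dotProduct_add, smul_dotProduct, dotProduct_smul,
      dotProduct_comm ((M - X) *ᵥ v) (X *ᵥ y), hXD, smul_eq_mul]
    ring
  have hst := h.enorm_sub_mulVec_mul_le (v := v) (y := y) (by rw [mulVec_mulVec]; exact hQv)
    (by rw [mulVec_mulVec]; exact hQy)
  have hst2 := pow_le_pow_left₀ (mul_nonneg (enorm_nonneg _) (enorm_nonneg _)) hst 2
  have hub := pow_le_pow_left₀ (enorm_nonneg _) (enorm_mulVec_le (M - B) (y + t • v)) 2
  have hwpos := enorm_pos hw0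
  refine le_of_sq_le_sq ?_ (mul_nonneg (spec_nonneg _) (enorm_nonneg _))
  refine le_of_mul_le_mul_right ?_ (pow_pos hwpos 2)
  calc enorm ((M - X) *ᵥ v) ^ 2 * enorm (y + t • v) ^ 2
      = (enorm ((M - X) *ᵥ v) * enorm y) ^ 2
        + t ^ 2 * enorm ((M - X) *ᵥ v) ^ 2 * enorm v ^ 2 := by rw [hn1]; ring
    _ ≤ (enorm (X *ᵥ y) * enorm v) ^ 2
        + t ^ 2 * enorm ((M - X) *ᵥ v) ^ 2 * enorm v ^ 2 := by linarith
    _ = enorm ((M - B) *ᵥ (y + t • v)) ^ 2 * enorm v ^ 2 := by rw [hn2]; ring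
    _ ≤ (spec (M - B) * enorm (y + t • v)) ^ 2 * enorm v ^ 2 := by gcongr
    _ = (spec (M - B) * enorm v) ^ 2 * enorm (y + t • v) ^ 2 := by ring

end BestApproximation

section Perturbation

variable {ι κ μ : Type*} [Fintype ι] [Fintype κ] {r : ℕ}

lemma bddBelow_spec_sub (M : Matrix ι κ ℝ) (k : ℕ) :
    BddBelow ((fun B => spec (M - B)) '' {B : Matrix ι κ ℝ | B.rank < k}) := by
  refine ⟨0, ?_⟩
  rintro _ ⟨B, -, rfl⟩
  exact spec_nonneg _

lemma sval_le_spec_sub (M : Matrix ι κ ℝ) {B : Matrix ι κ ℝ} {k : ℕ} (hB : B.rank < k) :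
    sval k M ≤ spec (M - B) :=
  csInf_le (bddBelow_spec_sub M k) ⟨B, hB, rfl⟩

lemma rank_eq_of_sval_pos {M : Matrix ι κ ℝ} (hM : M.rank ≤ r) (h : 0 < sval r M) :
    M.rank = r := by
  refine hM.eq_of_not_lt fun hlt => ?_
  have := sval_le_spec_sub M hlt
  rw [sub_self, spec_zero] at this
  linarith

lemma spec_pinv_mul_sval_le_one {M : Matrix ι κ ℝ} (hM : M.rank = r) (h : 0 < sval r M) :
    spec (pinv M) * sval r M ≤ 1 := by
  rw [← le_div_iff₀ h]
  refine spec_le (by positivity) fun x => ?_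
  by_cases hx : pinv M *ᵥ x = 0
  · rw [hx]
    have := mul_nonneg (one_div_nonneg.2 h.le) (enorm_nonneg x)
    simpa [enorm] using this
  obtain ⟨B, hB, hle⟩ := exists_rank_lt_spec_sub_mul_le M x hx
  have hs := sval_le_spec_sub M (hM ▸ hB)
  rw [div_mul_eq_mul_div, one_mul, le_div_iff₀ h, mul_comm]
  exact (mul_le_mul_of_nonneg_right hs (enorm_nonneg _)).trans hle

/-- Stability of the norm of the pseudoinverse under a perturbation that keeps the rank. -/
lemma spec_pinv_le {M X : Matrix ι κ ℝ} (hr : X.rank = M.rank) {δ : ℝ} (hδ : spec (M - X) ≤ δ)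
    (h : spec (pinv M) * δ < 1) : spec (pinv X) ≤ spec (pinv M) / (1 - spec (pinv M) * δ) := by
  have hpos : 0 < 1 - spec (pinv M) * δ := by linarith
  have hc := div_nonneg (spec_nonneg (pinv M)) hpos.le
  refine spec_le hc fun x => ?_
  by_cases hx : pinv X *ᵥ x = 0
  · rw [hx]
    have := mul_nonneg hc (enorm_nonneg x)
    simpa [enorm] using this
  obtain ⟨B, hB, hle⟩ := exists_rank_lt_spec_sub_mul_le X x hx
  have h1 := one_le_spec_pinv_mul_spec_sub M B (hr ▸ hB)
  have h2 : spec (M - B) ≤ δ + spec (X - B) := by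
    have := spec_add_le (M - X) (X - B)
    rw [sub_add_sub_cancel] at this
    linarith
  have h3 := mul_le_mul_of_nonneg_left h2 (spec_nonneg (pinv M))
  have h4 : 1 - spec (pinv M) * δ ≤ spec (pinv M) * spec (X - B) := by linarith
  rw [div_mul_eq_mul_div, le_div_iff₀ hpos]
  calc enorm (pinv X *ᵥ x) * (1 - spec (pinv M) * δ)
      ≤ enorm (pinv X *ᵥ x) * (spec (pinv M) * spec (X - B)) :=
        mul_le_mul_of_nonneg_left h4 (enorm_nonneg _)
    _ = spec (pinv M) * (spec (X - B) * enorm (pinv X *ᵥ x)) := by ring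
    _ ≤ spec (pinv M) * enorm x := mul_le_mul_of_nonneg_left hle (spec_nonneg _)

/-- If the rows of `U` are rows of `C` and `U` has the rank of `C`, then `C` factors through the
row space projection of `U`. -/
lemma mul_pinv_mul_of_submatrix (C : Matrix μ κ ℝ) (U : Matrix ι κ ℝ) (f : ι → μ)
    (hU : U = C.submatrix f id) (hr : C.rank ≤ U.rank) : C * pinv U * U = C := by
  classical
  have hker : LinearMap.ker C.mulVecLin = LinearMap.ker U.mulVecLin := by
    refine Submodule.eq_of_le_of_finrank_le (fun v hv => ?_) ?_
    · have hv' : C *ᵥ v = 0 := hv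
      change U *ᵥ v = 0
      ext i
      rw [hU]
      exact congrFun hv' (f i)
    · have h1 := rank_add_finrank_ker C
      have h2 := rank_add_finrank_ker U
      omega
  have hz (x : κ → ℝ) : C *ᵥ ((1 - pinv U * U) *ᵥ x) = 0 := by
    change (1 - pinv U * U) *ᵥ x ∈ LinearMap.ker C.mulVecLin
    rw [hker]
    change U *ᵥ ((1 - pinv U * U) *ᵥ x) = 0
    rw [mulVec_mulVec, Matrix.mul_sub, Matrix.mul_one, ← Matrix.mul_assoc, mul_pinv_mul, sub_self,
      zero_mulVec]
  have hz' : C * (1 - pinv U * U) = 0 :=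
    Matrix.ext_of_mulVec_single fun i => by rw [← mulVec_mulVec, hz, zero_mulVec]
  rw [Matrix.mul_sub, Matrix.mul_one, ← Matrix.mul_assoc, sub_eq_zero] at hz'
  exact hz'.symm

/-- The error of the perturbed factor, split into two first order terms and a term measuring the
rotation of the column space. -/
lemma mul_pinv_sub_mul_pinv_eq [DecidableEq ι] {C F : Matrix μ κ ℝ} {U E X : Matrix ι κ ℝ}
    (hC : C * pinv U * U = C) (hX : IsBestRank r (U + E) X) :
    (C + F) * pinv X - C * pinv U =
      F * pinv X - C * pinv U * (E * pinv X) -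
        C * pinv U * ((1 - X * pinv X) * (U * pinv U))ᵀ := by
  have h1 : (U + E) * pinv X = X * pinv X := by
    have := hX.sub_mul_pinv
    rwa [Matrix.sub_mul, sub_eq_zero] at this
  have h2 : U * pinv X = X * pinv X - E * pinv X := by
    rw [← h1, Matrix.add_mul, add_sub_cancel_right]
  have h3 : C * pinv X = C * pinv U * (X * pinv X) - C * pinv U * (E * pinv X) := by
    conv_lhs => rw [← hC, Matrix.mul_assoc, h2, Matrix.mul_sub]
  have h4 : C * pinv U * (U * pinv U) = C * pinv U := by rw [← Matrix.mul_assoc, hC]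
  rw [transpose_mul, transpose_mul_pinv, transpose_sub, transpose_one, transpose_mul_pinv,
    ← Matrix.mul_assoc (C * pinv U) (U * pinv U), h4, Matrix.mul_sub (C * pinv U), Matrix.mul_one,
    Matrix.add_mul, h3]
  abel

lemma one_sub_mul_pinv_mul_eq [DecidableEq ι] {U E X : Matrix ι κ ℝ}
    (hX : IsBestRank r (U + E) X) :
    (1 - X * pinv X) * (U * pinv U) =
      (U + E - X) * pinv U - (1 - X * pinv X) * (E * pinv U) := by
  have h := hX.mul_pinv_mul_sub
  rw [Matrix.mul_sub, mul_pinv_mul, sub_eq_zero, Matrix.mul_add] at h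
  have h' : U + E - X = (1 - X * pinv X) * U + (1 - X * pinv X) * E := by
    rw [← Matrix.mul_add, Matrix.sub_mul, Matrix.one_mul, Matrix.mul_add, h]
  rw [h', Matrix.add_mul, Matrix.mul_assoc, Matrix.mul_assoc, add_sub_cancel_right]

lemma spec_one_sub_mul_pinv_le [DecidableEq ι] (X : Matrix ι κ ℝ) :
    spec (1 - X * pinv X) ≤ 1 := by
  refine spec_le zero_le_one fun x => ?_
  rw [one_mul]
  refine enorm_mulVec_le_of_projection ?_ ?_ x
  · rw [transpose_sub, transpose_one, transpose_mul_pinv]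
  · rw [Matrix.mul_sub, Matrix.sub_mul, Matrix.sub_mul, mul_pinv_idem]
    simp

lemma two_mul_le_two_sqrt_two {a : ℝ} (ha : 0 ≤ a) : 2 * a ≤ 2 * Real.sqrt 2 * a := by
  have : (1 : ℝ) ≤ Real.sqrt 2 := Real.one_le_sqrt.2 one_le_two
  nlinarith

variable [Fintype μ]

/-- Perturbation bounds for `C * pinv U` when `U` is replaced by a best rank-`r` approximation of
a perturbation of `U`. -/
lemma mul_pinv_perturbation {C F : Matrix μ κ ℝ} {U E X : Matrix ι κ ℝ}
    (hC : C * pinv U * U = C) (hU : U.rank ≤ r) (hX : IsBestRank r (U + E) X)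
    (hσ : 4 * spec E < sval r U) :
    (spec ((C + F) * pinv X - C * pinv U) ≤
        spec (pinv U) * (spec (C * pinv U) * spec E + spec F) / (1 - 4 * spec (pinv U) * spec E)
          + 2 * Real.sqrt 2 * spec (C * pinv U) * spec (pinv U) * spec E) ∧
    (frob ((C + F) * pinv X - C * pinv U) ≤
        spec (pinv U) * (spec (C * pinv U) * frob E + frob F) / (1 - 4 * spec (pinv U) * spec E)
          + 2 * Real.sqrt 2 * spec (C * pinv U) * spec (pinv U) * frob E) := by
  classical
  have hE := spec_nonneg E
  have hp := spec_nonneg (pinv U)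
  have hs : 0 < sval r U := by linarith
  have hUr := rank_eq_of_sval_pos hU hs
  have hp1 := spec_pinv_mul_sval_le_one hUr hs
  have hD : spec (U + E - X) ≤ spec E := by simpa using hX.spec_sub_le hU
  have hDf : frob (U + E - X) ≤ frob E := by simpa using hX.2 U hU
  have hUX : spec (U - X) ≤ 2 * spec E := by
    have := spec_sub_le (U + E - X) E
    rw [sub_right_comm, add_sub_cancel_right] at this
    linarith
  have hXr : X.rank = r := by
    refine hX.1.eq_of_not_lt fun hlt => ?_
    have := sval_le_spec_sub U hlt
    linarith
  have hpE : 4 * spec (pinv U) * spec E < 1 := by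
    by_contra! hcon
    have hp0 : spec (pinv U) ≠ 0 := by
      intro h0
      rw [h0] at hcon
      linarith
    have := mul_lt_mul_of_pos_left hσ (lt_of_le_of_ne hp hp0.symm)
    linarith
  have hden : 0 < 1 - 4 * spec (pinv U) * spec E := by linarith
  have hpnn : 0 ≤ spec (pinv U) * spec E := mul_nonneg hp hE
  have hq : spec (pinv X) ≤ spec (pinv U) / (1 - 4 * spec (pinv U) * spec E) := by
    refine (spec_pinv_le (hXr.trans hUr.symm) hUX (by linarith)).trans ?_
    exact div_le_div_of_nonneg_left hp hden (by linarith)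
  have hc := spec_nonneg (C * pinv U)
  have hP := spec_one_sub_mul_pinv_le X
  have hscal {e f : ℝ} (he : 0 ≤ e) (hf : 0 ≤ f) :
      f * spec (pinv X) + spec (C * pinv U) * (e * spec (pinv X)) +
        spec (C * pinv U) * (e * spec (pinv U) + 1 * (e * spec (pinv U))) ≤
      spec (pinv U) * (spec (C * pinv U) * e + f) / (1 - 4 * spec (pinv U) * spec E)
          + 2 * Real.sqrt 2 * spec (C * pinv U) * spec (pinv U) * e := by
    have h1 := mul_le_mul_of_nonneg_left hq (add_nonneg (mul_nonneg hc he) hf)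
    have h2 := two_mul_le_two_sqrt_two (mul_nonneg (mul_nonneg hc hp) he)
    have h3 : spec (pinv U) * (spec (C * pinv U) * e + f) / (1 - 4 * spec (pinv U) * spec E) =
        (spec (C * pinv U) * e + f) * (spec (pinv U) / (1 - 4 * spec (pinv U) * spec E)) := by
      ring
    rw [h3]
    linarith
  rw [mul_pinv_sub_mul_pinv_eq hC hX, one_sub_mul_pinv_mul_eq hX]
  constructor
  · refine le_trans ?_ (hscal hE (spec_nonneg F))
    refine (spec_sub_le _ _).trans (add_le_add ((spec_sub_le _ _).trans (add_le_add
      (spec_mul_le _ _) ?_)) ?_)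
    · exact (spec_mul_le _ _).trans (mul_le_mul_of_nonneg_left (spec_mul_le _ _) hc)
    · refine (spec_mul_le _ _).trans (mul_le_mul_of_nonneg_left ?_ hc)
      rw [spec_transpose]
      refine (spec_sub_le _ _).trans (add_le_add ?_ ?_)
      · exact (spec_mul_le _ _).trans (mul_le_mul_of_nonneg_right hD hp)
      · exact (spec_mul_le _ _).trans
          (mul_le_mul hP (spec_mul_le _ _) (spec_nonneg _) zero_le_one)
  · refine le_trans ?_ (hscal (frob_nonneg E) (frob_nonneg F))
    refine (frob_sub_le _ _).trans (add_le_add ((frob_sub_le _ _).trans (add_le_add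
      (frob_mul_le_right _ _) ?_)) ?_)
    · exact (frob_mul_le_left _ _).trans (mul_le_mul_of_nonneg_left (frob_mul_le_right _ _) hc)
    · refine (frob_mul_le_left _ _).trans (mul_le_mul_of_nonneg_left ?_ hc)
      rw [frob_transpose]
      refine (frob_sub_le _ _).trans (add_le_add ?_ ?_)
      · exact (frob_mul_le_right _ _).trans (mul_le_mul_of_nonneg_right hDf hp)
      · exact (frob_mul_le_left _ _).trans
          (mul_le_mul hP (frob_mul_le_right _ _) (frob_nonneg _) zero_le_one)

end Perturbation

/-- **Matrix CUR perturbation** (Corollary `Cor: err_diff`). If `A` has rank `r`,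
`Ã = A + E`, `C = A(:,J)`, `U = A(I,J)`, `C̃ = Ã(:,J)`, `Ũ = Ã(I,J)`, `Ũ_r` is a best
rank-`r` approximation of `Ũ`, and `σ_r(U) > 4‖E_{I,J}‖₂`, then for both the spectral and
the Frobenius norm,
`‖C̃Ũ_r† − CU†‖ ≤ ‖U†‖₂(‖CU†‖₂‖E_{I,J}‖ + ‖E_J‖)/(1 − 4‖U†‖₂‖E_{I,J}‖₂)
  + 2√2‖CU†‖₂‖U†‖₂‖E_{I,J}‖`. -/
theorem matrix_cur_perturbation {m n : Type*} [Fintype m] [Fintype n] (r : ℕ)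
    (A E : Matrix m n ℝ) (hA : A.rank = r) (I : Finset m) (J : Finset n)
    (Ur : Matrix {x // x ∈ I} {y // y ∈ J} ℝ)
    (hUr : IsBestRank r (subM (A + E) I J) Ur)
    (hσ : 4 * spec (subM E I J) < sval r (subM A I J)) :
    (spec (colsubM (A + E) J * pinv Ur - colsubM A J * pinv (subM A I J)) ≤
        spec (pinv (subM A I J)) *
            (spec (colsubM A J * pinv (subM A I J)) * spec (subM E I J)
              + spec (colsubM E J)) /
            (1 - 4 * spec (pinv (subM A I J)) * spec (subM E I J))
          + 2 * Real.sqrt 2 * spec (colsubM A J * pinv (subM A I J)) *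
            spec (pinv (subM A I J)) * spec (subM E I J)) ∧
    (frob (colsubM (A + E) J * pinv Ur - colsubM A J * pinv (subM A I J)) ≤
        spec (pinv (subM A I J)) *
            (spec (colsubM A J * pinv (subM A I J)) * frob (subM E I J)
              + frob (colsubM E J)) /
            (1 - 4 * spec (pinv (subM A I J)) * spec (subM E I J))
          + 2 * Real.sqrt 2 * spec (colsubM A J * pinv (subM A I J)) *
            spec (pinv (subM A I J)) * frob (subM E I J)) := by
  have hC : colsubM A J * pinv (subM A I J) * subM A I J = colsubM A J := by
    refine mul_pinv_mul_of_submatrix _ _ Subtype.val rfl ?_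
    have hU : (subM A I J).rank ≤ r := hA ▸ rank_submatrix_le A _ _
    rw [rank_eq_of_sval_pos hU (lt_of_le_of_lt (mul_nonneg zero_le_four (spec_nonneg _)) hσ),
      ← hA]
    exact rank_submatrix_le A _ _
  exact mul_pinv_perturbation (F := colsubM E J) hC (hA ▸ rank_submatrix_le A _ _) hUr hσ

end TCUR
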